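/- Let D < 0 be an odd fundamental discriminant, k = ℚ(√D), and 𝔞 a nonzero fractional ideal of k. Then θ_𝔞 is a modular form of weight 1 and nebentypus χ_D for Γ₀(|D|): for every matrix [[a,b],[c,d]] ∈ SL₂(ℤ) with |D| ∣ c, every τ ∈ ℍ, and every positive odd integer d' with d' ≡ d (mod |D|), one has θ_𝔞((aτ+b)/(cτ+d)) = J(D | d') · (cτ + d) · θ_𝔞(τ), where J(D | d') denotes the Jacobi symbol. -/

import Mathlib

open NumberField
open scoped nonZeroDivisors

/-- The theta function of a fractional ideal `𝔞` of an imaginary quadratic field: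
`θ_𝔞(τ) = Σ_{a ∈ 𝔞} e(N(a)τ/N(𝔞))`, where `e(z) = exp(2πiz)`. -/
noncomputable def idealTheta (k : Type) [Field k] [NumberField k]
    (𝔞 : FractionalIdeal (𝓞 k)⁰ k) (τ : ℂ) : ℂ :=
  ∑' a : (𝔞 : Submodule (𝓞 k) k),
    Complex.exp (2 * Real.pi * Complex.I *
      ((Algebra.norm ℚ (a : k) / FractionalIdeal.absNorm 𝔞 : ℚ) : ℂ) * τ)

namespace ThetaAux
open Complex Real

lemma summable_gauss1 (c h : ℝ) (hc : 0 < c) :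
    Summable (fun n : ℤ => Real.exp (-c * ((n : ℝ) + h) ^ 2)) := by
  have h1 := ((summable_jacobiTheta₂_term_iff (Complex.I * (c * h / π : ℝ)) (Complex.I * (c / π : ℝ))).2
    (by simp; positivity)).norm
  refine (h1.mul_left (Real.exp (-c * h ^ 2))).congr fun n => ?_
  rw [norm_jacobiTheta₂_term, ← Real.exp_add]
  congr 1
  simp
  field_simp
  ring

lemma summable_gauss2 (c h₁ h₂ : ℝ) (hc : 0 < c) :
    Summable (fun v : ℤ × ℤ => Real.exp (-c * (((v.1 : ℝ) + h₁) ^ 2 + ((v.2 : ℝ) + h₂) ^ 2))) := by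
  refine ((summable_gauss1 c h₁ hc).mul_of_nonneg (summable_gauss1 c h₂ hc)
    (fun _ => (Real.exp_pos _).le) (fun _ => (Real.exp_pos _).le)).congr fun v => ?_
  rw [← Real.exp_add]
  congr 1
  ring

lemma posdef_bound (A B C : ℝ) (hA : 0 < A) (hN : 0 < 4 * A * C - B ^ 2) :
    ∃ ε > 0, ∀ x y : ℝ, ε * (x ^ 2 + y ^ 2) ≤ A * x ^ 2 + B * x * y + C * y ^ 2 := by
  have hC : 0 < C := by
    by_contra h
    push Not at h
    nlinarith [sq_nonneg B, mul_nonneg hA.le (neg_nonneg.2 h)]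
  refine ⟨(4 * A * C - B ^ 2) / (4 * (A + C)), by positivity, fun x y => ?_⟩
  rw [div_mul_eq_mul_div, div_le_iff₀ (by positivity)]
  nlinarith [sq_nonneg (2 * A * x + B * y), sq_nonneg (B * x + 2 * C * y)]

lemma norm_cexp_form (q : ℝ) (r : ℝ) (τ : ℂ) :
    ‖cexp (2 * π * I * (q * τ + r))‖ = Real.exp (-(2 * π * τ.im * q)) := by
  rw [Complex.norm_exp]
  congr 1
  simp
  ring

lemma summable_form (A B C : ℝ) (hA : 0 < A) (hN : 0 < 4 * A * C - B ^ 2) (h₁ h₂ : ℝ)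
    (r : ℤ × ℤ → ℝ) (τ : ℂ) (hτ : 0 < τ.im) :
    Summable (fun v : ℤ × ℤ => cexp (2 * π * I *
      (((A * (v.1 + h₁) ^ 2 + B * (v.1 + h₁) * (v.2 + h₂) + C * (v.2 + h₂) ^ 2 : ℝ) : ℂ) * τ
        + r v))) := by
  obtain ⟨ε, hε, hb⟩ := posdef_bound A B C hA hN
  refine Summable.of_norm_bounded (summable_gauss2 (2 * π * τ.im * ε) h₁ h₂ (by positivity))
    fun v => ?_
  rw [norm_cexp_form, Real.exp_le_exp]
  have := mul_le_mul_of_nonneg_left (hb (v.1 + h₁) (v.2 + h₂)) (show 0 ≤ 2 * π * τ.im by positivity)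
  linarith

lemma cpow_const (A N : ℝ) (hA : 0 < A) (hN : 0 < N) (τ : ℂ) (hτ : 0 < τ.im) :
    ((2 * A : ℝ) * (-I * τ)) ^ (1 / 2 : ℂ) * ((N / (2 * A) : ℝ) * (-I * τ)) ^ (1 / 2 : ℂ)
     = -I * τ * (√N : ℝ) := by
  have hw : (-I * τ) ≠ 0 := by
    intro h
    have : τ = 0 := by simpa using h
    simp [this] at hτ
  have key : ∀ r : ℝ, 0 < r → ((r : ℂ) * (-I * τ)) ^ (1 / 2 : ℂ)
      = (√r : ℝ) * (-I * τ) ^ (1 / 2 : ℂ) := by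
    intro r hr
    rw [Complex.cpow_def_of_ne_zero (mul_ne_zero (by exact_mod_cast hr.ne') hw),
      Complex.log_ofReal_mul hr hw, add_mul, Complex.exp_add, Complex.cpow_def_of_ne_zero hw,
      Real.sqrt_eq_rpow, Real.rpow_def_of_pos hr]
    push_cast
    rfl
  rw [key _ (by positivity), key _ (by positivity)]
  have h2 : (-I * τ) ^ (1 / 2 : ℂ) * (-I * τ) ^ (1 / 2 : ℂ) = -I * τ := by
    rw [← Complex.cpow_add _ _ hw]; norm_num
  have h3 : √(2 * A) * √(N / (2 * A)) = √N := by
    rw [← Real.sqrt_mul (by positivity)]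
    congr 1
    field_simp
  rw [← h3]
  push_cast
  linear_combination ((√(2 * A) : ℝ) : ℂ) * ((√(N / (2 * A)) : ℝ) : ℂ) * h2

lemma poisson2 (A B C N : ℝ) (hA : 0 < A) (hN : N = 4 * A * C - B ^ 2) (hN0 : 0 < N) (h₁ h₂ : ℝ)
    (τ : ℂ) (hτ : 0 < τ.im) :
    ∑' v : ℤ × ℤ, cexp (2 * π * I *
      ((A * (v.1 + h₁) ^ 2 + B * (v.1 + h₁) * (v.2 + h₂) + C * (v.2 + h₂) ^ 2) * τ))
    = I / (τ * (√N : ℝ)) * ∑' v : ℤ × ℤ, cexp (2 * π * I *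
      (-(C * v.1 ^ 2 - B * v.1 * v.2 + A * v.2 ^ 2) / (N * τ) + (v.1 * h₁ + v.2 * h₂))) := by
  have hτ0 : τ ≠ 0 := by rintro rfl; simp at hτ
  have hAc : (A : ℂ) ≠ 0 := by exact_mod_cast hA.ne'
  have hNc : (N : ℂ) ≠ 0 := by exact_mod_cast hN0.ne'
  have hC : 0 < C := by
    by_contra h
    push Not at h
    nlinarith [sq_nonneg B, mul_nonneg hA.le (neg_nonneg.2 h)]
  have him : 0 < (-1 / τ).im := by
    rw [neg_div, one_div, Complex.neg_im, Complex.inv_im]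
    have := Complex.normSq_pos.2 hτ0
    rw [neg_div, neg_neg]
    positivity
  set a₁ : ℂ := (2 * A : ℝ) * (-I * τ) with ha₁
  set a₂ : ℂ := (N / (2 * A) : ℝ) * (-I * τ) with ha₂
  have ha₁0 : a₁ ≠ 0 := by simp [ha₁, hτ0, hAc]
  have ha₁re : 0 < (1 / a₁).re := by
    rw [one_div, Complex.inv_re]
    have : 0 < a₁.re := by rw [ha₁, Complex.re_ofReal_mul]; simp; positivity
    have := Complex.normSq_pos.2 ha₁0
    positivity
  have ha₂re : 0 < a₂.re := by rw [ha₂, Complex.re_ofReal_mul]; simp; positivity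
  -- summabilities
  have S1 : Summable (fun v : ℤ × ℤ => cexp (2 * π * I *
      ((A * (v.1 + h₁) ^ 2 + B * (v.1 + h₁) * (v.2 + h₂) + C * (v.2 + h₂) ^ 2) * τ))) := by
    refine (summable_form A B C hA (hN ▸ hN0) h₁ h₂ 0 τ hτ).congr fun v => ?_
    push_cast
    simp
  have S3 : Summable (fun v : ℤ × ℤ => cexp (2 * π * I *
      (-(C * v.1 ^ 2 - B * v.1 * v.2 + A * v.2 ^ 2) / (N * τ) + (v.1 * h₁ + v.2 * h₂)))) := by
    refine (summable_form (C / N) (-B / N) (A / N) (by positivity) ?_ 0 0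
      (fun v => v.1 * h₁ + v.2 * h₂) (-1 / τ) him).congr fun v => ?_
    · have : 4 * (C / N) * (A / N) - (-B / N) ^ 2 = 1 / N := by
        field_simp
        rw [hN]; ring
      rw [this]; positivity
    · congr 2
      push_cast
      field_simp
      ring
  set g : ℤ × ℤ → ℂ := fun v => cexp (2 * π * I * (-(v.1 : ℂ) ^ 2 / (4 * A * τ)
     + v.1 * (h₁ + B * (v.2 + h₂) / (2 * A)) + N / (4 * A) * (v.2 + h₂) ^ 2 * τ)) with hg
  have S2 : Summable g := by
    refine Summable.of_norm ?_
    refine (((summable_gauss1 (2 * π * (-1 / τ).im / (4 * A)) 0 (by positivity))).mul_of_nonneg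
      (summable_gauss1 (2 * π * τ.im * (N / (4 * A))) h₂ (by positivity))
      (fun _ => (Real.exp_pos _).le) (fun _ => (Real.exp_pos _).le)).congr fun v => ?_
    have := norm_cexp_form (v.1 ^ 2 / (4 * A)) (v.1 * (h₁ + B * (v.2 + h₂) / (2 * A))) (-1 / τ)
    have h' := norm_cexp_form (N / (4 * A) * (v.2 + h₂) ^ 2) 0 τ
    have hgv : g v = cexp (2 * π * I * ((v.1 ^ 2 / (4 * A) : ℝ) * (-1 / τ) + (v.1 * (h₁ + B * (v.2 + h₂) / (2 * A)) : ℝ))) * cexp (2 * π * I * ((N / (4 * A) * (v.2 + h₂) ^ 2 : ℝ) * τ + (0 : ℝ))) := by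
      rw [← Complex.exp_add, hg]
      congr 1
      push_cast
      field_simp
      ring
    rw [hgv, norm_mul, this, h']
    congr 2 <;> (simp; try ring)
  -- first Poisson
  have P1 : ∀ y : ℤ, ∑' x : ℤ, cexp (2 * π * I *
      ((A * (x + h₁) ^ 2 + B * (x + h₁) * (y + h₂) + C * (y + h₂) ^ 2) * τ))
      = 1 / a₁ ^ (1 / 2 : ℂ) * ∑' x : ℤ, g (x, y) := by
    intro y
    set s : ℂ := h₁ + B * (y + h₂) / (2 * A) with hs
    have := Complex.tsum_exp_neg_quadratic ha₁re (I * s)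
    have hcp : (1 / a₁) ^ (1 / 2 : ℂ) = 1 / a₁ ^ (1 / 2 : ℂ) := by
      have hx : a₁.arg ≠ π := by
        intro h
        have h4 := (Complex.arg_eq_pi_iff.1 h).1
        have : 0 < a₁.re := by rw [ha₁, Complex.re_ofReal_mul]; simp; positivity
        linarith
      rw [one_div a₁, Complex.inv_cpow _ _ hx, one_div (a₁ ^ _)]
    have hne : a₁ ^ (1 / 2 : ℂ) ≠ 0 := by simp [Complex.cpow_eq_zero_iff, ha₁0]
    rw [hcp, one_div_one_div] at this
    have e1 : ∑' x : ℤ, g (x, y) = cexp (2 * π * I * (N / (4 * A) * (y + h₂) ^ 2 * τ)) *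
        ∑' n : ℤ, cexp (-π * (1 / a₁) * n ^ 2 + 2 * π * (I * s) * n) := by
      rw [← tsum_mul_left]
      refine tsum_congr fun x => ?_
      rw [← Complex.exp_add, hg]
      congr 1
      simp only [ha₁, hs]
      push_cast
      field_simp
      ring_nf
      simp
      try ring
    have e2 : ∑' x : ℤ, cexp (2 * π * I *
      ((A * (x + h₁) ^ 2 + B * (x + h₁) * (y + h₂) + C * (y + h₂) ^ 2) * τ)) = cexp (2 * π * I * (N / (4 * A) * (y + h₂) ^ 2 * τ)) * ∑' n : ℤ, cexp (-π / (1 / a₁) * (n + I * (I * s)) ^ 2) := by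
      rw [← tsum_mul_left, ← (Equiv.neg ℤ).tsum_eq]
      refine tsum_congr fun x => ?_
      rw [← Complex.exp_add]
      congr 1
      simp only [ha₁, hs, hN, ← mul_assoc, I_mul_I, Equiv.neg_apply]
      push_cast
      field_simp
      ring
    rw [e1, e2, this]
    field_simp
  have P2 : ∀ x : ℤ, ∑' y : ℤ, g (x, y) = 1 / a₂ ^ (1 / 2 : ℂ) * ∑' y : ℤ, cexp (2 * π * I *
      (-(C * x ^ 2 - B * x * y + A * y ^ 2) / (N * τ) + (x * h₁ + y * h₂))) := by
    intro x
    have := Complex.tsum_exp_neg_quadratic ha₂re (I * (B * x / (2 * A)) - a₂ * h₂)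
    have e1 : ∑' y : ℤ, g (x, y) = cexp (2 * π * I * (-(x : ℂ) ^ 2 / (4 * A * τ)
     + x * (h₁ + B * h₂ / (2 * A)) + N / (4 * A) * h₂ ^ 2 * τ)) * ∑' n : ℤ, cexp (-π * a₂ * n ^ 2 + 2 * π * (I * (B * x / (2 * A)) - a₂ * h₂) * n) := by
      rw [← tsum_mul_left]
      refine tsum_congr fun y => ?_
      rw [← Complex.exp_add, hg]
      congr 1
      simp only [ha₂]
      push_cast
      field_simp
      ring
    have e2 : ∑' y : ℤ, cexp (2 * π * I *
      (-(C * x ^ 2 - B * x * y + A * y ^ 2) / (N * τ) + (x * h₁ + y * h₂))) = cexp (2 * π * I * (-(x : ℂ) ^ 2 / (4 * A * τ)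
     + x * (h₁ + B * h₂ / (2 * A)) + N / (4 * A) * h₂ ^ 2 * τ)) * ∑' n : ℤ, cexp (-π / a₂ * (n + I * (I * (B * x / (2 * A)) - a₂ * h₂)) ^ 2) := by
      rw [← tsum_mul_left]
      refine tsum_congr fun y => ?_
      rw [← Complex.exp_add]
      congr 1
      have hCN : (C : ℂ) = (N + B ^ 2) / (4 * A) := by
        rw [hN]; push_cast; field_simp; ring
      simp only [ha₂, hCN]
      have hI4 : I ^ 4 = 1 := by simp
      have hI3 : I ^ 3 = -I := by simp
      push_cast
      field_simp
      ring_nf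
      simp only [I_sq, hI4, hI3]
      ring_nf
    rw [e1, e2, this]
    ring
  have sw : ∀ f : ℤ × ℤ → ℂ, Summable f → ∑' v, f v = ∑' y : ℤ, ∑' x : ℤ, f (x, y) := by
    intro f hf
    rw [← (Equiv.prodComm ℤ ℤ).tsum_eq]
    exact ((Equiv.prodComm ℤ ℤ).summable_iff.2 hf).tsum_prod
  rw [sw _ S1, S3.tsum_prod]
  simp_rw [P1]
  rw [tsum_mul_left]
  rw [← sw _ S2, S2.tsum_prod]
  simp_rw [P2]
  rw [tsum_mul_left, ← mul_assoc]
  congr 1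
  rw [one_div_mul_one_div, cpow_const A N hA hN0 τ hτ]
  have : ((√N : ℝ) : ℂ) ≠ 0 := by exact_mod_cast (Real.sqrt_pos.2 hN0).ne'
  field_simp
  simp

end ThetaAux

namespace ThetaAux
open Complex Real

lemma gauss1 (p : ℕ) [Fact p.Prime] (hp : p ≠ 2) (t : ZMod p) (ht : t ≠ 0) :
    ∑ x : ZMod p, ZMod.stdAddChar (N := p) (t * x ^ 2) =
      (quadraticChar (ZMod p) t : ℂ) *
      gaussSum ((quadraticChar (ZMod p)).ringHomComp (Int.castRingHom ℂ)) (ZMod.stdAddChar (N := p)) := by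
  have hprim := ZMod.isPrimitive_stdAddChar p
  have hchar : ringChar (ZMod p) ≠ 2 := by rwa [ZMod.ringChar_zmod_n]
  have h1 : ∑ x : ZMod p, ZMod.stdAddChar (N := p) (t * x ^ 2) =
      ∑ a : ZMod p, ((quadraticChar (ZMod p) a : ℂ) + 1) * ZMod.stdAddChar (N := p) (t * a) := by
    rw [← Finset.sum_fiberwise (s := Finset.univ) (g := fun x : ZMod p => x ^ 2)]
    refine Finset.sum_congr rfl fun a _ => ?_
    have := quadraticChar_card_sqrts hchar a
    rw [Finset.sum_congr rfl (g := fun _ => ZMod.stdAddChar (N := p) (t * a))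
      (fun x hx => by rw [(Finset.mem_filter.1 hx).2]), Finset.sum_const, nsmul_eq_mul]
    congr 1
    have h2 : ((quadraticChar (ZMod p) a : ℂ) + 1) = ((quadraticChar (ZMod p) a + 1 : ℤ) : ℂ) := by
      push_cast; rfl
    rw [h2, ← this]
    push_cast
    congr 2
    ext x
    simp
  rw [h1]
  simp_rw [add_mul, one_mul]
  rw [Finset.sum_add_distrib]
  have h0 : ∑ a : ZMod p, ZMod.stdAddChar (N := p) (t * a) = 0 := by
    have := AddChar.sum_mulShift (ψ := ZMod.stdAddChar (N := p)) t hprim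
    simp only [ht, if_false] at this
    simpa [mul_comm] using this
  rw [h0, add_zero]
  have := gaussSum_mulShift ((quadraticChar (ZMod p)).ringHomComp (Int.castRingHom ℂ))
    (ZMod.stdAddChar (N := p)) (Units.mk0 t ht)
  rw [← this, ← mul_assoc]
  simp only [Units.val_mk0, MulChar.ringHomComp_apply, gaussSum, AddChar.mulShift_apply]
  have hs := quadraticChar_sq_one (F := ZMod p) ht
  have hs' : (quadraticChar (ZMod p) t : ℂ) * (quadraticChar (ZMod p) t : ℂ) = 1 := by
    rw [← sq]; exact_mod_cast hs
  simp only [eq_intCast, hs', one_mul]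

lemma gauss2 (p : ℕ) [Fact p.Prime] (hp : p ≠ 2) (A B C b : ZMod p) (hb : b ≠ 0) (hA : A ≠ 0)
    (hD : B ^ 2 - 4 * A * C ≠ 0) :
    ∑ r : ZMod p × ZMod p, ZMod.stdAddChar (N := p) (b * (A * r.1 ^ 2 + B * r.1 * r.2 + C * r.2 ^ 2)) =
      (quadraticChar (ZMod p) (B ^ 2 - 4 * A * C) : ℂ) * p := by
  have h2 : (2 : ZMod p) ≠ 0 := by
    have : ((2 : ℕ) : ZMod p) ≠ 0 := by
      rw [Ne, ZMod.natCast_eq_zero_iff, Nat.prime_dvd_prime_iff_eq Fact.out Nat.prime_two]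
      exact hp
    exact_mod_cast this
  have h4 : (4 : ZMod p) ≠ 0 := by
    have : (4 : ZMod p) = 2 * 2 := by norm_num
    rw [this]; exact mul_ne_zero h2 h2
  have hchar : ringChar (ZMod p) ≠ 2 := by rwa [ZMod.ringChar_zmod_n]
  set D := B ^ 2 - 4 * A * C with hDd
  have e : ∑ r : ZMod p × ZMod p, ZMod.stdAddChar (N := p) (b * (A * r.1 ^ 2 + B * r.1 * r.2 + C * r.2 ^ 2))
     = (∑ x : ZMod p, ZMod.stdAddChar (N := p) ((b * A) * x ^ 2)) *
       ∑ y : ZMod p, ZMod.stdAddChar (N := p) ((-b * D / (4 * A)) * y ^ 2) := by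
    rw [Finset.sum_mul_sum, Fintype.sum_prod_type_right, Finset.sum_comm (s := Finset.univ)]
    rw [Finset.sum_comm]
    conv_rhs => rw [Finset.sum_comm]
    refine Finset.sum_congr rfl fun y _ => ?_
    refine Fintype.sum_equiv (Equiv.addRight (B * y / (2 * A))) _ _ fun x => ?_
    rw [← AddChar.map_add_eq_mul]
    congr 1
    simp only [Equiv.coe_addRight, hDd]
    field_simp
    ring
  rw [e, gauss1 p hp _ (mul_ne_zero hb hA), gauss1 p hp _ (by
    simp only [ne_eq, div_eq_zero_iff, mul_eq_zero, neg_eq_zero, hb, hD, h4, hA, or_self, not_false_eq_true])]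
  have hsq := gaussSum_sq (χ := (quadraticChar (ZMod p)).ringHomComp (Int.castRingHom ℂ)) (by
      exact (MulChar.ringHomComp_ne_one_iff (RingHom.injective_int _)).2 (quadraticChar_ne_one hchar))
    ((quadraticChar_isQuadratic (ZMod p)).comp _) (ZMod.isPrimitive_stdAddChar p)
  have hm : quadraticChar (ZMod p) (b * A) * quadraticChar (ZMod p) (-b * D / (4 * A)) * quadraticChar (ZMod p) (-1) = quadraticChar (ZMod p) D := by
    rw [← map_mul, ← map_mul]
    have : b * A * (-b * D / (4 * A)) * -1 = D * (b / 2) ^ 2 := by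
      field_simp
      ring
    rw [this, map_mul, quadraticChar_sq_one' (div_ne_zero hb h2), mul_one]
  rw [← hm]
  push_cast
  rw [ZMod.card] at hsq
  simp only [MulChar.ringHomComp_apply, eq_intCast] at hsq
  linear_combination (quadraticChar (ZMod p) (b * A) : ℂ) * (quadraticChar (ZMod p) (-b * D / (4 * A)) : ℂ) * hsq

lemma gauss_shift (p : ℕ) [Fact p.Prime] (A B C b c ξ η N : ZMod p) (hN : N = 4 * A * C - B ^ 2)
    (hbc : b * (N * c) = -1) :
    ∑ r : ZMod p × ZMod p, ZMod.stdAddChar (N := p)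
      (b * (A * r.1 ^ 2 + B * r.1 * r.2 + C * r.2 ^ 2) + ξ * r.1 + η * r.2) =
    ZMod.stdAddChar (N := p) (c * (C * ξ ^ 2 - B * ξ * η + A * η ^ 2)) *
    ∑ r : ZMod p × ZMod p, ZMod.stdAddChar (N := p)
      (b * (A * r.1 ^ 2 + B * r.1 * r.2 + C * r.2 ^ 2)) := by
  rw [Finset.mul_sum]
  refine Fintype.sum_equiv (Equiv.addRight
    (-c * (2 * C * ξ - B * η), -c * (2 * A * η - B * ξ))) _ _ fun r => ?_
  rw [← AddChar.map_add_eq_mul]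
  congr 1
  simp only [Equiv.coe_addRight, Prod.fst_add, Prod.snd_add]
  subst hN
  linear_combination (ξ * r.1 + η * r.2 - c * (C * ξ ^ 2 - B * ξ * η + A * η ^ 2)) * hbc

noncomputable def formTheta (A B C : ℤ) (τ : ℂ) : ℂ :=
  ∑' v : ℤ × ℤ, cexp (2 * π * I * ((A * v.1 ^ 2 + B * v.1 * v.2 + C * v.2 ^ 2) * τ))

lemma tsum_residue (p : ℕ) [NeZero p] (f : ℤ × ℤ → ℂ) (hf : Summable f) :
    ∑' v, f v = ∑ r : Fin p × Fin p, ∑' v : ℤ × ℤ, f (v.1 * p + (r.1 : ℕ), v.2 * p + (r.2 : ℕ)) := by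
  let E : (Fin p × Fin p) × (ℤ × ℤ) ≃ ℤ × ℤ :=
    (Equiv.prodComm _ _).trans ((Equiv.prodProdProdComm ℤ ℤ (Fin p) (Fin p)).trans
      ((Int.divModEquiv p).symm.prodCongr (Int.divModEquiv p).symm))
  rw [← E.tsum_eq]
  refine ((E.summable_iff.2 hf).tsum_prod).trans ?_
  rw [tsum_fintype]
  rfl

lemma formTheta_summable (A B C : ℤ) (hA : 0 < A) (hN : 0 < 4 * A * C - B ^ 2) (τ : ℂ)
    (hτ : 0 < τ.im) : Summable (fun v : ℤ × ℤ => cexp (2 * π * I * ((A * v.1 ^ 2 + B * v.1 * v.2 + C * v.2 ^ 2) * τ))) := by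
  refine (summable_form A B C (by exact_mod_cast hA) (by exact_mod_cast hN) 0 0 0 τ hτ).congr
    fun v => ?_
  simp

lemma formTheta_prime (A B C N : ℤ) (hA : 0 < A) (hN : N = 4 * A * C - B ^ 2) (hN0 : 0 < N)
    (p : ℕ) [Fact p.Prime] (hp : p ≠ 2) (hpA : ¬ (p : ℤ) ∣ A) (a b c : ℤ)
    (hdet : a * p - b * (N * c) = 1) (τ : ℂ) (hτ : 0 < τ.im) :
    formTheta A B C ((a * τ + b) / ((N * c : ℤ) * τ + p)) =
      (jacobiSym (-N) p : ℂ) * ((N * c : ℤ) * τ + p) * formTheta A B C τ := by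
  have hτ0 : τ ≠ 0 := by rintro rfl; simp at hτ
  have hp0 : (p : ℂ) ≠ 0 := by exact_mod_cast (Fact.out : p.Prime).ne_zero
  have hpr : (0 : ℝ) < p := by exact_mod_cast (Fact.out : p.Prime).pos
  have hN0c : (N : ℂ) ≠ 0 := by exact_mod_cast hN0.ne'
  set J : ℂ := (N * c : ℤ) * τ + p with hJ
  have hJ0 : J ≠ 0 := by
    intro h
    have him : (J).im = (N * c : ℤ) * τ.im := by simp [hJ]
    have hre : (J).re = (N * c : ℤ) * τ.re + p := by simp [hJ]
    rw [h] at him hre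
    simp only [zero_im, zero_re] at him hre
    have := (mul_eq_zero.1 him.symm).resolve_right hτ.ne'
    rw [this] at hre
    linarith
  set z : ℂ := τ / J with hz
  have hz0 : z ≠ 0 := div_ne_zero hτ0 hJ0
  have hzim : 0 < z.im := by
    have h1 : z.im = p * τ.im / normSq J := by
      rw [hz, Complex.div_im, hJ]
      simp
      ring
    rw [h1]
    have := normSq_pos.2 hJ0
    positivity
  have hdetc : (a : ℂ) * p - b * (N * c) = 1 := by exact_mod_cast hdet
  have hγ : (a * τ + b) / J = (z + b) / p := by
    rw [hz]
    field_simp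
    rw [hJ]; push_cast
    linear_combination τ * hdetc
  have hzinv : 1 / z = N * c + p / τ := by
    rw [hz, hJ]; push_cast; field_simp
  have hzp : 0 < ((z + b) / p).im := by
    have : (z + b) / p = ((1 / p : ℝ) : ℂ) * (z + b) := by push_cast; field_simp
    rw [this, Complex.im_ofReal_mul]
    simp
    positivity
  have hpz : 0 < ((p : ℂ) * z).im := by
    rw [show (p : ℂ) = ((p : ℝ) : ℂ) by simp, Complex.im_ofReal_mul]
    positivity
  set s : ℂ := ((√(N : ℝ) : ℝ) : ℂ) with hs
  have hs0 : s ≠ 0 := by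
    rw [hs]; exact_mod_cast (Real.sqrt_pos.2 (by exact_mod_cast hN0)).ne'
  -- dual theta
  have hAr : (0 : ℝ) < A := by exact_mod_cast hA
  have hNr : (0 : ℝ) < N := by exact_mod_cast hN0
  have hNe : (N : ℝ) = 4 * (A : ℝ) * C - (B : ℝ) ^ 2 := by exact_mod_cast hN
  set T : ℂ := ∑' v : ℤ × ℤ, cexp (2 * π * I *
      (-(C * v.1 ^ 2 - B * v.1 * v.2 + A * v.2 ^ 2) / (N * τ))) with hT
  have dual : formTheta A B C τ = I / (τ * s) * T := by
    have := poisson2 A B C N hAr hNe hNr 0 0 τ hτ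
    simpa [formTheta, hT, hs] using this
  have hCr : (0 : ℝ) < C := by
    by_contra h
    push Not at h
    nlinarith [sq_nonneg (B : ℝ), mul_nonneg hAr.le (neg_nonneg.2 h)]
  have Sdual : ∀ r : Fin p × Fin p, Summable (fun v : ℤ × ℤ => cexp (2 * π * I *
      (-(C * v.1 ^ 2 - B * v.1 * v.2 + A * v.2 ^ 2) / (N * (p * z))
        + (v.1 * ((r.1 : ℕ) / p) + v.2 * ((r.2 : ℕ) / p))))) := by
    intro r
    have him : 0 < (-1 / (p * z)).im := by
      have hz1 : (p : ℂ) * z ≠ 0 := mul_ne_zero hp0 hz0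
      rw [neg_div, one_div, Complex.neg_im, Complex.inv_im]
      have := Complex.normSq_pos.2 hz1
      rw [neg_div, neg_neg]
      positivity
    refine (summable_form (C / N) (-B / N) (A / N) (by positivity) ?_ 0 0
      (fun v => v.1 * ((r.1 : ℕ) / p) + v.2 * ((r.2 : ℕ) / p)) (-1 / (p * z)) him).congr fun v => ?_
    · have : 4 * ((C : ℝ) / N) * (A / N) - (-B / N) ^ 2 = 1 / N := by
        field_simp
        rw [hNe]; ring
      rw [this]; positivity
    · congr 2
      push_cast
      field_simp
      ring
  have hbc : (b : ZMod p) * (N * c) = -1 := by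
    have := congrArg (Int.cast : ℤ → ZMod p) hdet
    push_cast at this
    simp only [CharP.cast_eq_zero, mul_zero, zero_sub] at this
    linear_combination -this
  have hb0 : (b : ZMod p) ≠ 0 := by
    intro h; rw [h, zero_mul] at hbc; exact (neg_ne_zero.2 one_ne_zero) hbc.symm
  have hNp0 : (N : ZMod p) ≠ 0 := by
    intro h; rw [h, zero_mul, mul_zero] at hbc; exact (neg_ne_zero.2 one_ne_zero) hbc.symm
  have hA0 : (A : ZMod p) ≠ 0 := by
    rwa [Ne, ZMod.intCast_zmod_eq_zero_iff_dvd]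
  have hNp : (N : ZMod p) = 4 * A * C - B ^ 2 := by rw [hN]; push_cast; rfl
  have hG : ∑ r : ZMod p × ZMod p, ZMod.stdAddChar (N := p)
      (b * (A * r.1 ^ 2 + B * r.1 * r.2 + C * r.2 ^ 2)) = (jacobiSym (-N) p : ℂ) * p := by
    have hD : (B : ZMod p) ^ 2 - 4 * A * C = ((-N : ℤ) : ZMod p) := by push_cast; rw [hNp]; ring
    rw [gauss2 p hp A B C b hb0 hA0 (by rw [hD]; push_cast; exact neg_ne_zero.2 hNp0), hD,
      ← jacobiSym.legendreSym.to_jacobiSym]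
    rfl
  have hbij : Function.Bijective (fun r : Fin p × Fin p => (((r.1 : ℕ) : ZMod p), ((r.2 : ℕ) : ZMod p))) := by
    rw [Fintype.bijective_iff_injective_and_card]
    constructor
    · rintro ⟨r1, r2⟩ ⟨s1, s2⟩ h
      simp only [Prod.mk.injEq, ZMod.natCast_eq_natCast_iff', Nat.mod_eq_of_lt r1.2, Nat.mod_eq_of_lt r2.2, Nat.mod_eq_of_lt s1.2, Nat.mod_eq_of_lt s2.2] at h
      ext <;> simp [h.1, h.2]
    · simp [ZMod.card]
  -- main computation
  rw [hγ, formTheta, tsum_residue p _ (formTheta_summable A B C hA (hN ▸ hN0) _ hzp)]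
  have step : ∀ r : Fin p × Fin p, ∑' v : ℤ × ℤ, cexp (2 * π * I * ((A * ((v.1 * p + (r.1 : ℕ) : ℤ) : ℂ) ^ 2
      + B * ((v.1 * p + (r.1 : ℕ) : ℤ) : ℂ) * ((v.2 * p + (r.2 : ℕ) : ℤ) : ℂ)
      + C * ((v.2 * p + (r.2 : ℕ) : ℤ) : ℂ) ^ 2) * ((z + b) / p)))
      = I / (p * z * s) * ∑' v : ℤ × ℤ, cexp (2 * π * I * (b * (A * (r.1 : ℕ) ^ 2 + B * (r.1 : ℕ) * (r.2 : ℕ) + C * (r.2 : ℕ) ^ 2) / p)) * cexp (2 * π * I *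
      (-(C * v.1 ^ 2 - B * v.1 * v.2 + A * v.2 ^ 2) / (N * (p * z))
        + (v.1 * ((r.1 : ℕ) / p) + v.2 * ((r.2 : ℕ) / p)))) := by
    intro r
    have := poisson2 A B C N hAr hNe hNr ((r.1 : ℕ) / p) ((r.2 : ℕ) / p) (p * z) hpz
    push_cast at this
    rw [tsum_mul_left, mul_left_comm, hs, ← this, ← tsum_mul_left]
    refine tsum_congr fun v => ?_
    rw [← Complex.exp_add, Complex.exp_eq_exp_iff_exists_int]
    refine ⟨b * (A * (v.1 ^ 2 * p + 2 * v.1 * (r.1 : ℕ)) + B * (v.1 * v.2 * p + v.1 * (r.2 : ℕ) + v.2 * (r.1 : ℕ)) + C * (v.2 ^ 2 * p + 2 * v.2 * (r.2 : ℕ))), ?_⟩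
    push_cast
    field_simp
    ring
  simp only [step]
  rw [← Finset.mul_sum, ← Summable.tsum_finsetSum (fun r _ => (Sdual r).mul_left _)]
  have step2 : ∀ v : ℤ × ℤ, ∑ r : Fin p × Fin p, cexp (2 * π * I * (b * (A * (r.1 : ℕ) ^ 2 + B * (r.1 : ℕ) * (r.2 : ℕ) + C * (r.2 : ℕ) ^ 2) / p)) * cexp (2 * π * I *
      (-(C * v.1 ^ 2 - B * v.1 * v.2 + A * v.2 ^ 2) / (N * (p * z))
        + (v.1 * ((r.1 : ℕ) / p) + v.2 * ((r.2 : ℕ) / p)))) =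
      (jacobiSym (-N) p : ℂ) * p * cexp (2 * π * I *
      (-(C * v.1 ^ 2 - B * v.1 * v.2 + A * v.2 ^ 2) / (N * τ))) := by
    intro v
    have hgs := gauss_shift p A B C b c v.1 v.2 N hNp hbc
    rw [hG, ← hbij.sum_comp] at hgs
    have e1 : ∀ r : Fin p × Fin p, cexp (2 * π * I * (b * (A * (r.1 : ℕ) ^ 2 + B * (r.1 : ℕ) * (r.2 : ℕ) + C * (r.2 : ℕ) ^ 2) / p)) * cexp (2 * π * I *
      (-(C * v.1 ^ 2 - B * v.1 * v.2 + A * v.2 ^ 2) / (N * (p * z))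
        + (v.1 * ((r.1 : ℕ) / p) + v.2 * ((r.2 : ℕ) / p)))) =
        cexp (2 * π * I *
      (-(C * v.1 ^ 2 - B * v.1 * v.2 + A * v.2 ^ 2) / (N * (p * z)))) *
      ZMod.stdAddChar (N := p) (b * (A * ((r.1 : ℕ) : ZMod p) ^ 2 + B * ((r.1 : ℕ) : ZMod p) * ((r.2 : ℕ) : ZMod p) + C * ((r.2 : ℕ) : ZMod p) ^ 2) + v.1 * ((r.1 : ℕ) : ZMod p) + v.2 * ((r.2 : ℕ) : ZMod p)) := by
      intro r
      have := ZMod.stdAddChar_coe (N := p) (b * (A * (r.1 : ℕ) ^ 2 + B * (r.1 : ℕ) * (r.2 : ℕ) + C * (r.2 : ℕ) ^ 2) + v.1 * (r.1 : ℕ) + v.2 * (r.2 : ℕ))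
      push_cast at this
      rw [this, ← Complex.exp_add, ← Complex.exp_add]
      congr 1
      ring
    simp only [e1]
    rw [← Finset.mul_sum, hgs]
    have := ZMod.stdAddChar_coe (N := p) (c * (C * v.1 ^ 2 - B * v.1 * v.2 + A * v.2 ^ 2))
    push_cast at this
    rw [this, ← mul_assoc, ← Complex.exp_add, mul_comm]
    congr 2
    have hzz : ∀ q : ℂ, q / (N * (p * z)) = q / (N * p) * (1 / z) := by intro q; field_simp
    rw [hzz, hzinv]
    field_simp
    ring
  simp only [step2]
  rw [tsum_mul_left, ← hT, dual, hz]
  field_simp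

end ThetaAux

namespace ThetaAux
open Complex Real

lemma jacobi_flip (N n : ℕ) (hN : N % 4 = 3) (hn : Odd n) :
    jacobiSym (-(N : ℤ)) n = jacobiSym n N := by
  have hN2 : N % 2 = 1 := by omega
  rw [jacobiSym.neg _ hn]
  have h4 : n % 4 = 1 ∨ n % 4 = 3 := by have := Nat.odd_iff.1 hn; omega
  rcases h4 with h | h
  · rw [ZMod.χ₄_nat_one_mod_four h, one_mul,
      jacobiSym.quadratic_reciprocity_one_mod_four' (Nat.odd_iff.2 hN2) h]
  · rw [ZMod.χ₄_nat_three_mod_four h, jacobiSym.quadratic_reciprocity_three_mod_four hN h]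
    ring

lemma formTheta_add_int (A B C n : ℤ) (τ : ℂ) : formTheta A B C (τ + n) = formTheta A B C τ := by
  refine tsum_congr fun v => ?_
  rw [Complex.exp_eq_exp_iff_exists_int]
  refine ⟨(A * v.1 ^ 2 + B * v.1 * v.2 + C * v.2 ^ 2) * n, ?_⟩
  push_cast
  ring

lemma formTheta_modular (A B C : ℤ) (N : ℕ) (hA : 0 < A) (hN : (N : ℤ) = 4 * A * C - B ^ 2)
    (hN0 : 0 < N) (hodd : Odd N) (a b c d : ℤ) (hdet : a * d - b * c = 1) (hc : (N : ℤ) ∣ c)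
    (τ : ℂ) (hτ : 0 < τ.im) (d' : ℕ) (hd' : Odd d') (hdd : (d' : ℤ) ≡ d [ZMOD N]) :
    formTheta A B C ((a * τ + b) / (c * τ + d)) =
      (jacobiSym (-(N : ℤ)) d' : ℂ) * (c * τ + d) * formTheta A B C τ := by
  have hN4 : N % 4 = 3 := by
    have hB : Odd B := by
      by_contra h
      rw [Int.not_odd_iff_even] at h
      obtain ⟨m, hm⟩ := h
      obtain ⟨j, hj⟩ := hodd
      have : (2 : ℤ) * (2 * (A * C) - 2 * m ^ 2 - j) = 1 := by
        subst hm hj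
        push_cast at hN
        linear_combination -hN
      omega
    obtain ⟨m, hm⟩ := hB
    have : (N : ℤ) = 4 * (A * C - m ^ 2 - m - 1) + 3 := by
      subst hm; rw [hN]; ring
    omega
  rcases eq_or_ne c 0 with h0 | h0
  · subst h0
    simp only [mul_zero, sub_zero] at hdet
    rw [jacobi_flip N d' hN4 hd', jacobiSym.mod_left' hdd]
    rcases Int.eq_one_or_neg_one_of_mul_eq_one' hdet with ⟨h1, h2⟩ | ⟨h1, h2⟩
    · subst h1 h2
      simpa using formTheta_add_int A B C b τ
    · subst h1 h2
      rw [jacobiSym.at_neg_one hodd, ZMod.χ₄_nat_three_mod_four hN4]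
      have := formTheta_add_int A B C (-b) τ
      simp only [Int.cast_neg, Int.cast_one, Int.cast_zero, zero_mul, zero_add]
      rw [mul_neg_one, neg_neg, one_mul, ← this]
      congr 1
      push_cast
      ring
  · have hcop : IsCoprime d (c.natAbs : ℤ) := by
      have : IsCoprime d c := ⟨a, -b, by linear_combination hdet⟩
      rw [Int.natCast_natAbs]
      exact this.abs_right
    obtain ⟨p, hpg, hpp, hpd⟩ := Nat.forall_exists_prime_gt_and_zmodEq (2 + A.natAbs)
      (by simpa using h0) hcop
    haveI : Fact p.Prime := ⟨hpp⟩
    have hcd : c ∣ p - d := by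
      have := hpd.symm.dvd
      rwa [Int.natAbs_dvd] at this
    obtain ⟨n, hn⟩ := hcd
    obtain ⟨c', hc'⟩ := hc
    have hp2 : p ≠ 2 := by omega
    have hpA : ¬ (p : ℤ) ∣ A := by
      intro h
      have := Int.le_of_dvd hA h
      omega
    have key := formTheta_prime A B C N hA hN (by exact_mod_cast hN0) p hp2 hpA a (b + n * a) c'
      (by rw [← hc']; linear_combination hdet + a * hn) (τ - n) (by simpa using hτ)
    have e := formTheta_add_int A B C (-n) τ
    push_cast at e
    rw [← sub_eq_add_neg] at e
    have hnc : (p : ℂ) - d = c * n := by exact_mod_cast hn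
    have hden : ((N * c' : ℤ) : ℂ) * (τ - n) + p = c * τ + d := by
      rw [← hc']; linear_combination hnc
    have hnum : (a : ℂ) * (τ - n) + (b + n * a : ℤ) = a * τ + b := by push_cast; ring
    rw [hden, hnum, e] at key
    rw [key]
    congr 3
    rw [jacobi_flip N d' hN4 hd', jacobi_flip N p hN4 (hpp.odd_of_ne_two hp2)]
    apply jacobiSym.mod_left'
    have : (p : ℤ) ≡ d [ZMOD N] := by
      symm
      rw [Int.modEq_iff_dvd, hn, hc']
      exact (dvd_mul_right _ _).mul_right _
    exact this.trans hdd.symm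

end ThetaAux

namespace ThetaAux
open Complex Real

lemma norm_div_int (k : Type) [Field k] [NumberField k]
    (𝔞 : FractionalIdeal (𝓞 k)⁰ k) (h𝔞 : 𝔞 ≠ 0) (x : k) (hx : x ∈ 𝔞) :
    ∃ n : ℤ, Algebra.norm ℚ x / FractionalIdeal.absNorm 𝔞 = n := by
  have hle : FractionalIdeal.spanSingleton (𝓞 k)⁰ x ≤ 𝔞 := by
    rwa [FractionalIdeal.spanSingleton_le_iff_mem]
  have hb : FractionalIdeal.spanSingleton (𝓞 k)⁰ x * 𝔞⁻¹ ≤ 1 := by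
    rw [← mul_inv_cancel₀ h𝔞]
    exact mul_le_mul_left hle _
  obtain ⟨I, hI⟩ := FractionalIdeal.le_one_iff_exists_coeIdeal.1 hb
  have h1 := congrArg FractionalIdeal.absNorm hI
  rw [FractionalIdeal.coeIdeal_absNorm, map_mul, map_inv₀, FractionalIdeal.absNorm_span_singleton] at h1
  rcases abs_choice (Algebra.norm ℚ x) with h | h <;> rw [h] at h1
  · exact ⟨Ideal.absNorm I, by rw [div_eq_mul_inv, ← h1]; simp⟩
  · exact ⟨-Ideal.absNorm I, by rw [div_eq_mul_inv]; push_cast; linarith⟩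

lemma norm_form (k : Type) [Field k] [NumberField k]
    (hdeg : Module.finrank ℚ k = 2) (b : Fin 2 → k) :
    ∃ P Q R : ℚ, (∀ x y : ℚ, Algebra.norm ℚ (x • b 0 + y • b 1) = P * x ^ 2 + Q * x * y + R * y ^ 2)
      ∧ Algebra.discr ℚ b = Q ^ 2 - 4 * P * R := by
  have hcard : Fintype.card (k →ₐ[ℚ] ℂ) = 2 := by rw [AlgHom.card, hdeg]
  obtain ⟨e⟩ : Nonempty (Fin 2 ≃ (k →ₐ[ℚ] ℂ)) := ⟨(Fintype.equivFinOfCardEq hcard).symm⟩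
  have hn : ∀ x : k, ((Algebra.norm ℚ x : ℚ) : ℂ) = e 0 x * e 1 x := by
    intro x
    have := Algebra.norm_eq_prod_embeddings ℚ ℂ x
    rw [← e.prod_comp, Fin.prod_univ_two] at this
    simpa using this
  have hd := Algebra.discr_eq_det_embeddingsMatrixReindex_pow_two ℚ ℂ b e
  rw [Matrix.det_fin_two] at hd
  simp only [Algebra.embeddingsMatrixReindex, Algebra.embeddingsMatrix, Matrix.reindex_apply, Matrix.submatrix_apply, Matrix.of_apply, Equiv.refl_symm, Equiv.coe_refl, id, Equiv.symm_symm, eq_ratCast] at hd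
  refine ⟨Algebra.norm ℚ (b 0), Algebra.norm ℚ (b 0 + b 1) - Algebra.norm ℚ (b 0) - Algebra.norm ℚ (b 1), Algebra.norm ℚ (b 1), ?_, ?_⟩
  · intro x y
    have : (Rat.cast : ℚ → ℂ).Injective := Rat.cast_injective
    apply this
    push_cast
    simp only [hn, map_add, Rat.smul_def, map_mul, map_ratCast]
    ring
  · have : (Rat.cast : ℚ → ℂ).Injective := Rat.cast_injective
    apply this
    push_cast
    simp only [hn, map_add]
    rw [hd]
    ring

open Module in
lemma idealTheta_eq (D : ℤ) (hDneg : D < 0)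
    (k : Type) [Field k] [NumberField k]
    (hdeg : Module.finrank ℚ k = 2) (hdisc : NumberField.discr k = D)
    (𝔞 : FractionalIdeal (𝓞 k)⁰ k) (h𝔞 : 𝔞 ≠ 0) :
    ∃ A B C : ℤ, 0 < A ∧ B ^ 2 - 4 * A * C = D ∧ ∀ τ, idealTheta k 𝔞 τ = formTheta A B C τ := by
  let I : (FractionalIdeal (𝓞 k)⁰ k)ˣ := Units.mk0 𝔞 h𝔞
  have hc1 : Fintype.card (Free.ChooseBasisIndex ℤ I) = 2 := by
    rw [← finrank_eq_card_basis (basisOfFractionalIdeal k I), hdeg]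
  have hc2 : Fintype.card (Free.ChooseBasisIndex ℤ (𝓞 k)) = 2 := by
    rw [← finrank_eq_card_basis (integralBasis k), hdeg]
  let e1 : Free.ChooseBasisIndex ℤ I ≃ Fin 2 := Fintype.equivFinOfCardEq hc1
  let e2 : Free.ChooseBasisIndex ℤ (𝓞 k) ≃ Fin 2 := Fintype.equivFinOfCardEq hc2
  have hdet := det_basisOfFractionalIdeal_eq_absNorm k I (e2.trans e1.symm)
  set M : ℚ := FractionalIdeal.absNorm 𝔞 with hM
  have hM0 : M ≠ 0 := by rw [hM, Ne, FractionalIdeal.absNorm_eq_zero_iff]; exact h𝔞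
  have hMpos : 0 < M := lt_of_le_of_ne (FractionalIdeal.absNorm_nonneg _) hM0.symm
  let bQ : Basis (Fin 2) ℚ k := (basisOfFractionalIdeal k I).reindex e1
  let bZ : Basis (Fin 2) ℤ (𝔞 : Submodule (𝓞 k) k) := (fractionalIdealBasis k 𝔞).reindex e1
  have hbQZ : ∀ i, bQ i = (bZ i : k) := by
    intro i
    have h1 : bZ i = fractionalIdealBasis k 𝔞 (e1.symm i) := Basis.reindex_apply _ _ _
    have h2 : bQ i = basisOfFractionalIdeal k I (e1.symm i) := Basis.reindex_apply _ _ _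
    rw [h1, h2]
    exact basisOfFractionalIdeal_apply k I _
  have hdisc2 : Algebra.discr ℚ bQ = M ^ 2 * D := by
    have h1 : Algebra.discr ℚ bQ = Algebra.discr ℚ ((basisOfFractionalIdeal k I).reindex (e2.trans e1.symm).symm) := by
      have := Algebra.discr_reindex ℚ bQ e2.symm
      rw [← this]
      congr 1
      ext i
      simp [bQ]
    rw [h1, ← Basis.toMatrix_map_vecMul (integralBasis k) ((basisOfFractionalIdeal k I).reindex (e2.trans e1.symm).symm), Algebra.discr_of_matrix_vecMul, ← Basis.det_apply, ← sq_abs, hdet, ← coe_discr, hdisc]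
    rfl
  obtain ⟨P, Q, R, hform, hPQR⟩ := norm_form k hdeg bQ
  have hint : ∀ v : ℤ × ℤ, ∃ n : ℤ, (P * v.1 ^ 2 + Q * v.1 * v.2 + R * v.2 ^ 2) / M = n := by
    intro v
    have hx : (v.1 : ℚ) • bQ 0 + (v.2 : ℚ) • bQ 1 = ((v.1 • bZ 0 + v.2 • bZ 1 : (𝔞 : Submodule (𝓞 k) k)) : k) := by
      simp [hbQZ, Rat.smul_def]
    obtain ⟨n, hn⟩ := norm_div_int k 𝔞 h𝔞 _ (v.1 • bZ 0 + v.2 • bZ 1 : (𝔞 : Submodule (𝓞 k) k)).2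
    rw [← hx, hform] at hn
    exact ⟨n, hn⟩
  obtain ⟨A, hA⟩ := hint (1, 0)
  obtain ⟨C, hC⟩ := hint (0, 1)
  obtain ⟨S, hS⟩ := hint (1, 1)
  simp only [Int.cast_one, Int.cast_zero] at hA hC hS
  have hP : P = A * M := by rw [← hA]; field_simp; ring
  have hR : R = C * M := by rw [← hC]; field_simp; ring
  have hQ : Q = (S - A - C) * M := by rw [← hA, ← hC, ← hS]; field_simp; ring
  have hD : ((S - A - C) ^ 2 - 4 * A * C : ℚ) = D := by
    rw [hPQR, hP, hQ, hR] at hdisc2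
    have : M ^ 2 ≠ 0 := pow_ne_zero _ hM0
    apply mul_left_cancel₀ this
    linear_combination hdisc2
  have hDz : (S - A - C) ^ 2 - 4 * A * C = D := by exact_mod_cast hD
  refine ⟨A, S - A - C, C, ?_, hDz, ?_⟩
  · have h1 := bQ.sum_repr 1
    rw [Fin.sum_univ_two] at h1
    have h2 := hform (bQ.repr 1 0) (bQ.repr 1 1)
    rw [h1, map_one, hP, hQ, hR] at h2
    set x := bQ.repr 1 0
    set y := bQ.repr 1 1
    have hA0 : A ≠ 0 := by
      rintro rfl
      nlinarith [sq_nonneg (S - 0 - C)]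
    have hDq : (D : ℚ) < 0 := by exact_mod_cast hDneg
    have h3 : 4 * (A : ℚ) = M * ((2 * A * x + (S - A - C) * y) ^ 2 - D * y ^ 2) := by
      rw [← hD]
      linear_combination 4 * A * h2
    have h4 : 0 ≤ (A : ℚ) := by
      have : 0 ≤ M * ((2 * A * x + (S - A - C) * y) ^ 2 - D * y ^ 2) := by
        apply mul_nonneg hMpos.le
        nlinarith [sq_nonneg (2 * A * x + (S - A - C) * y), mul_nonneg (neg_nonneg.2 hDq.le) (sq_nonneg y)]
      linarith
    exact lt_of_le_of_ne (by exact_mod_cast h4) hA0.symm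
  · intro τ
    let E : ℤ × ℤ ≃ (𝔞 : Submodule (𝓞 k) k) :=
      (finTwoArrowEquiv ℤ).symm.trans bZ.equivFun.symm.toEquiv
    rw [idealTheta, formTheta, ← E.tsum_eq]
    refine tsum_congr fun v => ?_
    have hE : ((E v : (𝔞 : Submodule (𝓞 k) k)) : k) = (v.1 : ℚ) • bQ 0 + (v.2 : ℚ) • bQ 1 := by
      simp [E, hbQZ, Rat.smul_def, Basis.equivFun_symm_apply, Fin.sum_univ_two]
    rw [hE, hform, hP, hQ, hR]
    have : ((A * M * (v.1 : ℚ) ^ 2 + (S - A - C) * M * v.1 * v.2 + C * M * v.2 ^ 2) / M : ℚ)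
      = A * v.1 ^ 2 + (S - A - C) * v.1 * v.2 + C * v.2 ^ 2 := by field_simp
    rw [this]
    push_cast
    congr 1
    ring

end ThetaAux

/-- Let `D < 0` be an odd fundamental discriminant, `k = ℚ(√D)`, and `𝔞` a
nonzero fractional ideal of `k`.  Then `θ_𝔞` is a modular form of weight 1 and nebentypus
`χ_D` for `Γ₀(|D|)`: for every `γ = [[a,b],[c,d]] ∈ SL₂(ℤ)` with `|D| ∣ c`, every `τ ∈ ℍ`,
and every positive odd natural number `d'` with `d' ≡ d (mod |D|)`, one has
`θ_𝔞((aτ+b)/(cτ+d)) = J(D|d') ⬝ (cτ+d) ⬝ θ_𝔞(τ)`, where `J(D|d')` is the Jacobi symbol. -/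
theorem idealTheta_modular
    (D : ℤ) (hDneg : D < 0) (hDodd : Odd D)
    (k : Type) [Field k] [NumberField k]
    (hdeg : Module.finrank ℚ k = 2) (hdisc : NumberField.discr k = D)
    (𝔞 : FractionalIdeal (𝓞 k)⁰ k) (h𝔞 : 𝔞 ≠ 0)
    (γ : Matrix.SpecialLinearGroup (Fin 2) ℤ) (hc : (D.natAbs : ℤ) ∣ γ.1 1 0)
    (τ : ℂ) (hτ : 0 < τ.im)
    (d' : ℕ) (hd'pos : 0 < d') (hd'odd : Odd d')
    (hd'cong : (d' : ℤ) ≡ γ.1 1 1 [ZMOD (D.natAbs : ℤ)]) :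
    idealTheta k 𝔞 (((γ.1 0 0 : ℂ) * τ + (γ.1 0 1 : ℂ)) / ((γ.1 1 0 : ℂ) * τ + (γ.1 1 1 : ℂ)))
      = (jacobiSym D d' : ℂ) * ((γ.1 1 0 : ℂ) * τ + (γ.1 1 1 : ℂ)) * idealTheta k 𝔞 τ := by
  obtain ⟨A, B, C, hA, hD, hθ⟩ := ThetaAux.idealTheta_eq D hDneg k hdeg hdisc 𝔞 h𝔞
  rw [hθ, hθ]
  have hDN : D = -(D.natAbs : ℤ) := by omega
  have hdet : γ.1 0 0 * γ.1 1 1 - γ.1 0 1 * γ.1 1 0 = 1 := by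
    have := γ.2
    rwa [Matrix.det_fin_two] at this
  have := ThetaAux.formTheta_modular A B C D.natAbs hA (by rw [← neg_eq_iff_eq_neg.2 hDN]; linarith)
    (by omega) (Int.natAbs_odd.2 hDodd) _ _ _ _ hdet hc τ hτ d' hd'odd hd'cong
  rwa [← hDN] at this
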